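/- For every r_f > 0 there exists a constant C > 0 such that for every M > 0, every closed disk B_M ⊆ ℝ² of radius M, and all 0 ≤ b₋ < b₊ ≤ r_f and 0 ≤ d₋ < d₊ ≤ r_f, the triple integral ∫_{B_M} ∫_{B_M} ∫_{B_M} 1{b₋ < |y₁ − y₂|/2 ≤ b₊} · 1{y₃ ∈ D_{d₋,d₊}(y₁,y₂)} dy₃ dy₂ dy₁ is at most C · |B_M| · d₊² · (δ_b ∨ δ_d)^{1/2} · (δ_b ∧ δ_d), where δ_b = b₊ − b₋, δ_d = d₊ − d₋, and |B_M| is the Lebesgue area of B_M. -/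

import Mathlib

open MeasureTheory Real
open scoped Classical

noncomputable section

/-- The Euclidean plane. -/
abbrev E2 : Type := EuclideanSpace ℝ (Fin 2)

/-- Rotation of a planar vector by `π/2`; it is orthogonal to `v` and has the same norm. -/
def perp (v : E2) : E2 := (WithLp.equiv 2 (Fin 2 → ℝ)).symm ![-(v 1), v 0]

/-- For `d ≥ a := |x − y|/2`, the closed disk of radius `d` whose boundary circle passes
through `x` and `y`, with center `midpoint x y + sgn·√(d² − a²)·n`, where `n` is the unit
vector orthogonal to `y − x` obtained by normalizing `perp (y - x)`; for `d < a` it is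
empty.  `sgn = 1` gives `B_d^+(x,y)` and `sgn = -1` gives `B_d^-(x,y)`. -/
def diskPM (x y : E2) (d : ℝ) (sgn : ℝ) : Set E2 :=
  if d < ‖y - x‖ / 2 then ∅
  else Metric.closedBall
    (midpoint ℝ x y + ((sgn * Real.sqrt (d ^ 2 - (‖y - x‖ / 2) ^ 2)) / ‖y - x‖) • perp (y - x)) d

/-- The set `D_{d₋,d₊}(x,y)` of points `z` such that the boundaries of the three equal disks
around `x`, `y`, `z` meet at a time `r` with `d₋ < r ≤ d₊`; empty when `x = y`. -/
def Dset (x y : E2) (dm dp : ℝ) : Set E2 :=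
  if x = y then ∅
  else
    (diskPM x y dp 1 ∪ diskPM x y dp (-1)) \
      (diskPM x y (max dm (‖y - x‖ / 2)) 1 ∪ diskPM x y (max dm (‖y - x‖ / 2)) (-1))

end

lemma my_sqrt_add (x y : ℝ) (hx : 0 ≤ x) (hy : 0 ≤ y) : √(x+y) ≤ √x + √y := by
  rw [Real.sqrt_le_iff]
  refine ⟨by positivity, ?_⟩
  have := Real.sq_sqrt hx
  have := Real.sq_sqrt hy
  have : 0 ≤ √x * √y := by positivity
  nlinarith

lemma perp_norm (v : E2) : ‖perp v‖ = ‖v‖ := by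
  simp only [EuclideanSpace.norm_eq, Fin.sum_univ_two, perp]
  simp [add_comm]

lemma g_le_sqrt (s R a : ℝ) (h : s ≤ R) (hs : 0 ≤ s) :
    √(R^2-a^2) - √(s^2-a^2) ≤ √(R^2-s^2) := by
  have h1 : R^2 - a^2 ≤ max (s^2-a^2) 0 + (R^2-s^2) := by
    linarith [le_max_left (s^2-a^2) 0]
  have h2 := Real.sqrt_le_sqrt h1
  have h3 := my_sqrt_add (max (s^2-a^2) 0) (R^2-s^2) (le_max_right _ _) (by nlinarith)
  have h4 : √(max (s^2-a^2) 0) = √(s^2-a^2) := by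
    rcases le_total (s^2-a^2) 0 with h | h
    · rw [max_eq_right h, Real.sqrt_eq_zero_of_nonpos h, Real.sqrt_zero]
    · rw [max_eq_left h]
  linarith

lemma g_nonneg (s R a : ℝ) (h : s ≤ R) (hs : 0 ≤ s) :
    0 ≤ √(R^2-a^2) - √(s^2-a^2) := by
  have : √(s^2-a^2) ≤ √(R^2-a^2) := Real.sqrt_le_sqrt (by nlinarith)
  linarith

lemma g_le_inv (s R a : ℝ) (h : s ≤ R) (hs : 0 ≤ s) (ha : 0 ≤ a) (haR : a < R) :
    √(R^2-a^2) - √(s^2-a^2) ≤ 2 * √R * (R - s) / √(R-a) := by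
  have hp : 0 < √(R-a) := Real.sqrt_pos.2 (by linarith)
  have hR : 0 < R := by linarith
  have hpR : 0 < √R := Real.sqrt_pos.2 hR
  rw [le_div_iff₀ hp]
  have e1 : √R * √(R-a) ≤ √(R^2-a^2) := by
    rw [← Real.sqrt_mul hR.le]
    exact Real.sqrt_le_sqrt (by nlinarith)
  have e2 : (√(R^2-a^2) - √(s^2-a^2)) * √(R^2-a^2) ≤ R^2 - s^2 := by
    have q1 := Real.sq_sqrt (show 0 ≤ R^2-a^2 by nlinarith)
    have q0 : √(s^2-a^2) ≤ √(R^2-a^2) := Real.sqrt_le_sqrt (by nlinarith)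
    have q2 := Real.sqrt_nonneg (s^2-a^2)
    rcases le_total (s^2-a^2) 0 with h | h
    · rw [Real.sqrt_eq_zero_of_nonpos h]; nlinarith
    · have := Real.sq_sqrt h
      nlinarith
  have e3 : (√(R^2-a^2) - √(s^2-a^2)) * (√R * √(R-a)) ≤ 2 * R * (R - s) := by
    calc _ ≤ (√(R^2-a^2) - √(s^2-a^2)) * √(R^2-a^2) :=
          mul_le_mul_of_nonneg_left e1 (g_nonneg s R a h hs)
      _ ≤ _ := e2
      _ ≤ _ := by nlinarith
  have q := Real.mul_self_sqrt hR.le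
  have : ((√(R^2-a^2) - √(s^2-a^2)) * √(R-a)) * √R ≤ (2 * √R * (R - s)) * √R := by
    calc _ = (√(R^2-a^2) - √(s^2-a^2)) * (√R * √(R-a)) := by ring
      _ ≤ _ := e3
      _ = _ := by linear_combination (-2*(R-s)) * q
  exact le_of_mul_le_mul_right this hpR

lemma int_g_le (s R bm bp : ℝ) (h : s ≤ R) (hs : 0 ≤ s) (hb : 0 ≤ bm) (hbb : bm ≤ bp) :
    ∫ a in bm..bp, (√(R^2-a^2) - √(s^2-a^2)) ≤ 4 * √R * (R - s) * √(bp - bm) := by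
  have key := intervalIntegral.integral_le_sub_of_hasDeriv_right_of_le hbb
    (g := fun a => -(4 * √R * (R-s)) * √(R-a))
    (g' := fun a => 2 * √R * (R - s) / √(R-a))
    (φ := fun a => √(R^2-a^2) - √(s^2-a^2)) (by fun_prop) ?_ ?_ ?_
  · refine key.trans ?_
    have h1 : √(R-bm) ≤ √(R-bp) + √(bp-bm) := by
      rcases le_total (R-bp) 0 with h | h
      · have : √(R-bm) ≤ √(bp-bm) := Real.sqrt_le_sqrt (by linarith)
        linarith [Real.sqrt_nonneg (R-bp)]
      · have := my_sqrt_add _ _ h (sub_nonneg.2 hbb)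
        rwa [show R - bp + (bp-bm) = R - bm by ring] at this
    have h2 : 0 ≤ 4 * √R * (R-s) := by
      have := Real.sqrt_nonneg R
      have : 0 ≤ R - s := by linarith
      positivity
    nlinarith
  · intro x hx
    rcases lt_or_ge x R with hxR | hxR
    · have h1 : HasDerivAt (fun a => √(R-a)) ((-1) / (2 * √(R-x))) x :=
        ((hasDerivAt_id x).const_sub R).sqrt (by simp; linarith)
      have h2 := (h1.const_mul (-(4 * √R * (R-s)))).hasDerivWithinAt (s := Set.Ioi x)
      have hp : 0 < √(R-x) := Real.sqrt_pos.2 (by linarith)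
      have he : 2 * √R * (R - s) / √(R - x) =
          -(4 * √R * (R - s)) * (-1 / (2 * √(R - x))) := by
        field_simp
        ring
      rw [he]
      exact h2
    · have : √(R-x) = 0 := Real.sqrt_eq_zero_of_nonpos (by linarith)
      rw [this, div_zero]
      refine (hasDerivWithinAt_const x (Set.Ioi x) (0:ℝ)).congr ?_ ?_
      · intro y hy
        have hy' : x < y := hy
        rw [Real.sqrt_eq_zero_of_nonpos (show R - y ≤ 0 by linarith), mul_zero]
      · simp [this]
  · exact (Continuous.continuousOn (by fun_prop)).integrableOn_Icc
  · intro x hx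
    rcases lt_or_ge x R with hxR | hxR
    · exact g_le_inv s R x h hs (by linarith [hx.1]) hxR
    · have : √(R-x) = 0 := Real.sqrt_eq_zero_of_nonpos (by linarith)
      simp only [this, div_zero]
      rw [Real.sqrt_eq_zero_of_nonpos (show R^2 - x^2 ≤ 0 by nlinarith)]
      linarith [Real.sqrt_nonneg (s^2-x^2)]

lemma int_g_le' (s R bm bp : ℝ) (h : s ≤ R) (hs : 0 ≤ s) (hbb : bm ≤ bp) :
    ∫ a in bm..bp, (√(R^2-a^2) - √(s^2-a^2)) ≤ 2 * √R * √(R - s) * (bp - bm) := by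
  have h0 : 2 * √R * √(R - s) * (bp - bm) = ∫ a in bm..bp, 2 * √R * √(R - s) := by
    simp; ring
  rw [h0]
  refine intervalIntegral.integral_mono_on hbb (Continuous.intervalIntegrable (by fun_prop) _ _)
    (by simp) fun x _ => (g_le_sqrt s R x h hs).trans ?_
  have : √(R^2-s^2) ≤ √(4 * R * (R-s)) := Real.sqrt_le_sqrt (by nlinarith)
  refine this.trans (le_of_eq ?_)
  have hR : 0 ≤ R := by linarith
  rw [Real.sqrt_mul (by positivity), Real.sqrt_mul (by norm_num)]
  congr 2
  rw [show (4:ℝ) = 2^2 by norm_num, Real.sqrt_sq (by norm_num)]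

lemma int_g_final (s R bm bp : ℝ) (h : s ≤ R) (hs : 0 ≤ s) (hb : 0 ≤ bm) (hbb : bm ≤ bp) :
    ∫ a in bm..bp, (√(R^2-a^2) - √(s^2-a^2)) ≤
      4 * √R * √(max (bp-bm) (R-s)) * min (bp-bm) (R-s) := by
  rcases le_total (bp-bm) (R-s) with hh | hh
  · rw [max_eq_right hh, min_eq_left hh]
    refine (int_g_le' s R bm bp h hs hbb).trans ?_
    have : 0 ≤ √R * √(R - s) * (bp - bm) := by
      have : 0 ≤ bp - bm := by linarith
      positivity
    linarith
  · rw [max_eq_left hh, min_eq_right hh]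
    refine (int_g_le s R bm bp h hs hb hbb).trans (le_of_eq (by ring))

lemma vol_cb (c : E2) (r : ℝ) (hr : 0 ≤ r) : volume.real (Metric.closedBall c r) = π * r^2 := by
  rw [Measure.real, EuclideanSpace.volume_closedBall_fin_two]
  simp [hr, Real.pi_pos.le]
  ring

lemma vol_crescent (c₁ c₂ : E2) (R e h : ℝ) (he : 0 ≤ e) (heR : e ≤ R) (hh : dist c₁ c₂ ≤ h) :
    volume.real (Metric.closedBall c₁ R \ Metric.closedBall c₂ e) ≤ 2 * π * R * (R - e + h) := by
  have h0 : 0 ≤ h := dist_nonneg.trans hh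
  have hR : 0 ≤ R := he.trans heR
  have hpi := Real.pi_pos
  have hfin : volume (Metric.closedBall c₁ R) ≠ ⊤ := measure_closedBall_lt_top.ne
  rcases le_total h e with hc | hc
  · have hsub : Metric.closedBall c₁ (e - h) ⊆ Metric.closedBall c₂ e :=
      Metric.closedBall_subset_closedBall' (by linarith)
    calc _ ≤ volume.real (Metric.closedBall c₁ R \ Metric.closedBall c₁ (e-h)) :=
          measureReal_mono (Set.diff_subset_diff_right hsub) (measure_ne_top_of_subset Set.diff_subset hfin)
      _ = π * R^2 - π * (e-h)^2 := by
          rw [measureReal_diff (Metric.closedBall_subset_closedBall (by linarith)) Metric.isClosed_closedBall.measurableSet hfin, vol_cb _ _ hR,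
            vol_cb _ _ (by linarith)]
      _ ≤ _ := by
          have : R^2 - (e-h)^2 ≤ 2 * R * (R-e+h) := by nlinarith [sq_nonneg (R-(e-h))]
          nlinarith
  · calc _ ≤ volume.real (Metric.closedBall c₁ R) := measureReal_mono Set.diff_subset hfin
      _ = π * R^2 := vol_cb _ _ hR
      _ ≤ _ := by
        have : R^2 ≤ 2 * R * (R-e+h) := by nlinarith
        nlinarith

lemma g_ge (e R a : ℝ) (ha : 0 ≤ a) (hae : a ≤ e) (heR : e ≤ R) :
    R - e ≤ √(R^2-a^2) - √(e^2-a^2) := by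
  rcases eq_or_lt_of_le (show 0 ≤ e by linarith) with h | h
  · have : a = 0 := by linarith
    subst this; rw [← h]; simp [Real.sqrt_sq (show 0 ≤ R by linarith)]
  have q1 := Real.sq_sqrt (show 0 ≤ R^2-a^2 by nlinarith)
  have q2 := Real.sq_sqrt (show 0 ≤ e^2-a^2 by nlinarith)
  have p1 : √(R^2-a^2) ≤ R := Real.sqrt_le_iff.2 ⟨by linarith, by nlinarith⟩
  have p2 : √(e^2-a^2) ≤ e := Real.sqrt_le_iff.2 ⟨by linarith, by nlinarith⟩
  have p3 : √(e^2-a^2) ≤ √(R^2-a^2) := Real.sqrt_le_sqrt (by nlinarith)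
  have : (R-e)*(R+e) ≤ (√(R^2-a^2) - √(e^2-a^2))*(R+e) := by nlinarith
  exact le_of_mul_le_mul_right this (by linarith)

lemma vol_pm (x y : E2) (hxy : x ≠ y) (R e sgn : ℝ) (hs : |sgn| = 1) (hae : ‖y-x‖/2 ≤ e) (heR : e ≤ R) :
    volume.real (diskPM x y R sgn \ diskPM x y e sgn) ≤
      4 * π * R * (√(R^2-(‖y-x‖/2)^2) - √(e^2-(‖y-x‖/2)^2)) := by
  unfold diskPM
  rw [if_neg (by linarith), if_neg (by linarith)]
  have hn : 0 < ‖y-x‖ := norm_pos_iff.2 (sub_ne_zero.2 hxy.symm)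
  have g1 := g_ge e R (‖y-x‖/2) (by positivity) hae heR
  refine (vol_crescent _ _ R e (√(R^2-(‖y-x‖/2)^2) - √(e^2-(‖y-x‖/2)^2)) (by linarith) heR ?_).trans ?_
  · rw [dist_add_left, dist_eq_norm, ← sub_smul, norm_smul, perp_norm, ← sub_div, ← mul_sub,
      norm_div, norm_mul, Real.norm_eq_abs, hs, norm_norm, div_mul_cancel₀ _ hn.ne', one_mul,
      Real.norm_eq_abs, abs_of_nonneg (by linarith)]
  · have : 0 ≤ 2 * π * R := by
      have : 0 ≤ R := by linarith
      positivity
    nlinarith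

lemma vol_D (x y : E2) (dm dp : ℝ) (h0 : 0 ≤ dm) (h : dm ≤ dp) :
    volume.real (Dset x y dm dp) ≤
      8 * π * dp * (√(dp^2-(‖x-y‖/2)^2) - √(dm^2-(‖x-y‖/2)^2)) := by
  have hnn : 0 ≤ 8 * π * dp * (√(dp^2-(‖x-y‖/2)^2) - √(dm^2-(‖x-y‖/2)^2)) := by
    have := g_nonneg dm dp (‖x-y‖/2) h h0
    have : 0 ≤ dp := by linarith
    positivity
  by_cases hxy : x = y
  · simpa [Dset, hxy] using hnn
  by_cases hap : dp < ‖y-x‖/2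
  · simpa [Dset, hxy, diskPM, hap] using hnn
  rw [norm_sub_rev x y] at *
  push Not at hap
  set e := max dm (‖y-x‖/2) with he
  have hsub : Dset x y dm dp ⊆ (diskPM x y dp 1 \ diskPM x y e 1) ∪ (diskPM x y dp (-1) \ diskPM x y e (-1)) := by
    unfold Dset
    rw [if_neg hxy]
    rintro z ⟨h1 | h1, h2⟩
    · exact Or.inl ⟨h1, fun h => h2 (Or.inl h)⟩
    · exact Or.inr ⟨h1, fun h => h2 (Or.inr h)⟩
  have hf : ∀ s : ℝ, volume (diskPM x y dp s \ diskPM x y e s) ≠ ⊤ := by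
    intro s
    refine measure_ne_top_of_subset Set.diff_subset ?_
    unfold diskPM
    split_ifs
    · simp
    · exact measure_closedBall_lt_top.ne
  have hee : √(e^2-(‖y-x‖/2)^2) = √(dm^2-(‖y-x‖/2)^2) := by
    rcases le_total dm (‖y-x‖/2) with hc | hc
    · rw [he, max_eq_right hc, sub_self, Real.sqrt_zero, Real.sqrt_eq_zero_of_nonpos]
      nlinarith
    · rw [he, max_eq_left hc]
  have a1 := vol_pm x y hxy dp e 1 (by simp) (le_max_right _ _) (max_le h hap)
  have a2 := vol_pm x y hxy dp e (-1) (by simp) (le_max_right _ _) (max_le h hap)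
  rw [hee] at a1 a2
  have := measureReal_mono hsub (measure_union_ne_top (hf _) (hf _))
  have := measureReal_union_le (μ := volume) (diskPM x y dp 1 \ diskPM x y e 1) (diskPM x y dp (-1) \ diskPM x y e (-1))
  linarith

lemma measurable_diskPM (x y : E2) (d s : ℝ) : MeasurableSet (diskPM x y d s) := by
  unfold diskPM
  split_ifs
  · exact MeasurableSet.empty
  · exact Metric.isClosed_closedBall.measurableSet

lemma measurable_Dset (x y : E2) (dm dp : ℝ) : MeasurableSet (Dset x y dm dp) := by
  unfold Dset
  split_ifs
  · exact MeasurableSet.empty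
  · exact ((measurable_diskPM _ _ _ _).union (measurable_diskPM _ _ _ _)).diff
      ((measurable_diskPM _ _ _ _).union (measurable_diskPM _ _ _ _))

lemma vol_disk_fin (x y : E2) (d s : ℝ) : volume (diskPM x y d s) ≠ ⊤ := by
  unfold diskPM
  split_ifs
  · simp
  · exact measure_closedBall_lt_top.ne

lemma vol_D_fin (x y : E2) (dm dp : ℝ) : volume (Dset x y dm dp) ≠ ⊤ := by
  unfold Dset
  split_ifs
  · simp
  · exact measure_ne_top_of_subset Set.diff_subset
      (measure_union_ne_top (vol_disk_fin _ _ _ _) (vol_disk_fin _ _ _ _))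

lemma polar_bound (s R bm bp : ℝ) (h : s ≤ R) (hs : 0 ≤ s) (hb : 0 ≤ bm) (hbb : bm ≤ bp)
    (F : ℝ → ℝ) (hF : F = fun ρ => if ρ / 2 ∈ Set.Ioc bm bp then
      8 * π * R * (√(R^2-(ρ/2)^2) - √(s^2-(ρ/2)^2)) else 0) :
    Integrable (fun y : E2 => F ‖y‖) ∧
    ∫ y : E2, F ‖y‖ ≤ 64 * π^2 * R^2 * ∫ a in bm..bp, (√(R^2-a^2) - √(s^2-a^2)) := by
  have hR : 0 ≤ R := by linarith
  set G : ℝ → ℝ := fun ρ => ρ * (8 * π * R * (√(R^2-(ρ/2)^2) - √(s^2-(ρ/2)^2))) with hG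
  have hGc : Continuous G := by fun_prop
  have hdim : Module.finrank ℝ E2 = 2 := by simp
  have hFG : (fun y : ℝ => y ^ (Module.finrank ℝ E2 - 1) • F y) =
      Set.indicator (Set.Ioc (2*bm) (2*bp)) G := by
    funext y
    rw [hdim, hF]
    have hiff : y / 2 ∈ Set.Ioc bm bp ↔ y ∈ Set.Ioc (2*bm) (2*bp) := by
      simp only [Set.mem_Ioc]
      constructor <;> rintro ⟨h1, h2⟩ <;> constructor <;> linarith
    by_cases hy : y ∈ Set.Ioc (2*bm) (2*bp)
    · rw [Set.indicator_of_mem hy]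
      simp only [hiff, hy, if_true, hG, smul_eq_mul]
      norm_num
    · rw [Set.indicator_of_notMem hy]
      simp only [hiff, hy, if_false, smul_zero]
  have hint : Integrable (Set.indicator (Set.Ioc (2*bm) (2*bp)) G) := by
    rw [integrable_indicator_iff measurableSet_Ioc]
    exact hGc.integrableOn_Ioc
  constructor
  · rw [integrable_fun_norm_addHaar (volume : Measure E2) (f := F), hFG]
    exact hint.integrableOn
  · rw [integral_fun_norm_addHaar (volume : Measure E2) F, hFG,
      setIntegral_eq_integral_of_forall_compl_eq_zero, integral_indicator measurableSet_Ioc,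
      ← intervalIntegral.integral_of_le (by linarith), hdim]
    swap
    · intro x hx
      apply Set.indicator_of_notMem
      intro hx'
      exact hx (lt_of_le_of_lt (by linarith) hx'.1)
    have hv : volume.real (Metric.ball (0:E2) 1) = π := by
      rw [Measure.real, EuclideanSpace.volume_ball_fin_two]
      simp [Real.pi_pos.le]
    rw [hv]
    have hle : ∫ ρ in (2*bm)..(2*bp), G ρ ≤
        ∫ ρ in (2*bm)..(2*bp), 16 * π * R^2 * (√(R^2-(ρ/2)^2) - √(s^2-(ρ/2)^2)) := by
      refine intervalIntegral.integral_mono_on (by linarith) (hGc.intervalIntegrable _ _)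
        (Continuous.intervalIntegrable (by fun_prop) _ _) fun x hx => ?_
      have hx0 : 0 ≤ x := by linarith [hx.1]
      have hg := g_nonneg s R (x/2) h hs
      have hpi := Real.pi_pos
      rcases le_total x (2*R) with hc | hc
      · calc G x ≤ (2*R) * (8 * π * R * (√(R^2-(x/2)^2) - √(s^2-(x/2)^2))) :=
              mul_le_mul_of_nonneg_right hc (by positivity)
          _ = _ := by ring
      · have e1 : √(R^2-(x/2)^2) = 0 := Real.sqrt_eq_zero_of_nonpos (by nlinarith)
        have e2 : √(s^2-(x/2)^2) = 0 := Real.sqrt_eq_zero_of_nonpos (by nlinarith)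
        simp [hG, e1, e2]
    rw [intervalIntegral.integral_const_mul,
      intervalIntegral.integral_comp_div (fun a => √(R^2-a^2) - √(s^2-a^2)) two_ne_zero,
      mul_div_cancel_left₀ _ two_ne_zero, mul_div_cancel_left₀ _ two_ne_zero] at hle
    have : π * ∫ ρ in (2*bm)..(2*bp), G ρ ≤ π * _ := mul_le_mul_of_nonneg_left hle Real.pi_pos.le
    simp only [nsmul_eq_mul, smul_eq_mul] at this ⊢
    push_cast
    linarith

/-- **Lemma 7.6.** For every `r_f > 0` there is a constant `C > 0` such that for every
closed disk `B_M` of radius `M > 0` and all `0 ≤ b₋ < b₊ ≤ r_f`, `0 ≤ d₋ < d₊ ≤ r_f`,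
`∫_{B_M³} 1{b₋ < |y₁−y₂|/2 ≤ b₊} 1{y₃ ∈ D_{d₋,d₊}(y₁,y₂)} dy₃ dy₂ dy₁
  ≤ C·|B_M|·d₊²·(δ_b ∨ δ_d)^{1/2}·(δ_b ∧ δ_d)`. -/
theorem triple_integral_one_edge_bound (rf : ℝ) (hrf : 0 < rf) :
    ∃ C > 0, ∀ (M : ℝ), 0 < M → ∀ (c : E2) (bm bp dm dp : ℝ),
      0 ≤ bm → bm < bp → bp ≤ rf → 0 ≤ dm → dm < dp → dp ≤ rf →
      (∫ y₁ in Metric.closedBall c M, ∫ y₂ in Metric.closedBall c M,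
          ∫ y₃ in Metric.closedBall c M,
            (if ‖y₁ - y₂‖ / 2 ∈ Set.Ioc bm bp then (1 : ℝ) else 0) *
              (if y₃ ∈ Dset y₁ y₂ dm dp then (1 : ℝ) else 0))
        ≤ C * (volume (Metric.closedBall c M)).toReal * dp ^ 2 *
            Real.sqrt (max (bp - bm) (dp - dm)) * min (bp - bm) (dp - dm) := by
  
  have hpi := Real.pi_pos
  refine ⟨256 * π^2 * √rf, by positivity, ?_⟩
  intro M hM c bm bp dm dp hbm hb hbp hdm hd hdp
  set F : ℝ → ℝ := fun ρ => if ρ / 2 ∈ Set.Ioc bm bp then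
      8 * π * dp * (√(dp^2-(ρ/2)^2) - √(dm^2-(ρ/2)^2)) else 0 with hF
  have hdp0 : 0 ≤ dp := by linarith
  obtain ⟨hFi, hFb⟩ := polar_bound dm dp bm bp hd.le hdm hbm hb.le F hF
  have hF0 : ∀ ρ, 0 ≤ F ρ := by
    intro ρ
    simp only [hF]
    split_ifs
    · have := g_nonneg dm dp (ρ/2) hd.le hdm
      positivity
    · exact le_rfl
  set K := 64 * π^2 * dp^2 * ∫ a in bm..bp, (√(dp^2-a^2) - √(dm^2-a^2)) with hK
  have h3 : ∀ y₁ y₂ : E2, (∫ y₃ in Metric.closedBall c M,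
            (if ‖y₁ - y₂‖ / 2 ∈ Set.Ioc bm bp then (1 : ℝ) else 0) *
              (if y₃ ∈ Dset y₁ y₂ dm dp then (1 : ℝ) else 0)) ≤ F ‖y₁ - y₂‖ := by
    intro y₁ y₂
    rw [integral_const_mul]
    simp only [hF]
    split_ifs with hc
    · rw [one_mul]
      refine le_trans ?_ (vol_D y₁ y₂ dm dp hdm hd.le)
      have hm : MeasurableSet (Dset y₁ y₂ dm dp) := measurable_Dset _ _ _ _
      have : (fun y₃ => if y₃ ∈ Dset y₁ y₂ dm dp then (1 : ℝ) else 0) =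
          Set.indicator (Dset y₁ y₂ dm dp) 1 := by
        funext z; simp [Set.indicator_apply]
      rw [this, integral_indicator_one hm, measureReal_restrict_apply hm]
      exact measureReal_mono Set.inter_subset_left (vol_D_fin _ _ _ _)
    · simp
  have h30 : ∀ y₁ y₂ : E2, 0 ≤ (∫ y₃ in Metric.closedBall c M,
            (if ‖y₁ - y₂‖ / 2 ∈ Set.Ioc bm bp then (1 : ℝ) else 0) *
              (if y₃ ∈ Dset y₁ y₂ dm dp then (1 : ℝ) else 0)) := by
    intro y₁ y₂
    refine integral_nonneg fun z => ?_
    positivity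
  have h2 : ∀ y₁ : E2, (∫ y₂ in Metric.closedBall c M, ∫ y₃ in Metric.closedBall c M,
            (if ‖y₁ - y₂‖ / 2 ∈ Set.Ioc bm bp then (1 : ℝ) else 0) *
              (if y₃ ∈ Dset y₁ y₂ dm dp then (1 : ℝ) else 0)) ≤ K := by
    intro y₁
    have hi : Integrable (fun y₂ : E2 => F ‖y₁ - y₂‖) := hFi.comp_sub_left y₁
    calc _ ≤ ∫ y₂ in Metric.closedBall c M, F ‖y₁ - y₂‖ :=
          integral_mono_of_nonneg (Filter.Eventually.of_forall (h30 y₁)) hi.integrableOn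
            (Filter.Eventually.of_forall (h3 y₁))
      _ ≤ ∫ y₂, F ‖y₁ - y₂‖ :=
          setIntegral_le_integral hi (Filter.Eventually.of_forall fun _ => hF0 _)
      _ = ∫ y : E2, F ‖y‖ := integral_sub_left_eq_self (fun y : E2 => F ‖y‖) volume y₁
      _ ≤ K := hFb
  have h1 : (∫ y₁ in Metric.closedBall c M, ∫ y₂ in Metric.closedBall c M,
          ∫ y₃ in Metric.closedBall c M,
            (if ‖y₁ - y₂‖ / 2 ∈ Set.Ioc bm bp then (1 : ℝ) else 0) *
              (if y₃ ∈ Dset y₁ y₂ dm dp then (1 : ℝ) else 0))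
        ≤ ∫ y₁ in Metric.closedBall c M, K := by
    refine integral_mono_of_nonneg
      (Filter.Eventually.of_forall fun y₁ => integral_nonneg (h30 y₁)) ?_
      (Filter.Eventually.of_forall h2)
    exact integrableOn_const measure_closedBall_lt_top.ne
  refine h1.trans ?_
  rw [setIntegral_const, smul_eq_mul, Measure.real]
  set V := (volume (Metric.closedBall c M)).toReal
  have hV : 0 ≤ V := ENNReal.toReal_nonneg
  have hmin : 0 ≤ min (bp - bm) (dp - dm) := le_min (by linarith) (by linarith)
  have hKb : K ≤ 256 * π^2 * √rf * dp^2 * √(max (bp - bm) (dp - dm)) * min (bp - bm) (dp - dm) := by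
    calc K ≤ 64 * π^2 * dp^2 * (4 * √dp * √(max (bp-bm) (dp-dm)) * min (bp-bm) (dp-dm)) :=
          mul_le_mul_of_nonneg_left (int_g_final dm dp bm bp hd.le hdm hbm hb.le) (by positivity)
      _ ≤ 64 * π^2 * dp^2 * (4 * √rf * √(max (bp-bm) (dp-dm)) * min (bp-bm) (dp-dm)) := by
          gcongr
      _ = _ := by ring
  calc V * K ≤ V * _ := mul_le_mul_of_nonneg_left hKb hV
    _ = _ := by ring
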